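/- (Transformation theorem T→S) For integers L, M ≥ 0 and integers a, b with ab ≥ 0, and such that |a| ≤ M whenever |b| ≤ M and |a+b| ≤ L, Σ_{i=0}^M q^{i²/2} [L+M-i choose L] T(i, L-i, b, a) = q^{b²/2} S(L, M, a+b, b). -/

import Mathlib

open Finset

noncomputable section

/-- The field of rational functions over ℚ in which the identities are stated. -/
abbrev K : Type := RatFunc ℚ

/-- The variable. -/
def tq : K := RatFunc.X

/-- Gaussian binomial coefficient `[n choose k]` in the variable `p`:
`∏_{j=1}^{k} (1 - p^(n-k+j))/(1 - p^j)` when `0 ≤ k ≤ n`, and `0` otherwise. -/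
def gb (p : K) (n k : ℤ) : K :=
  if 0 ≤ k ∧ k ≤ n then
    ∏ j ∈ Finset.range k.toNat, (1 - p ^ (n - k + 1 + (j : ℤ))) / (1 - p ^ (1 + (j : ℤ)))
  else 0

/-- The refined q-trinomial `T(L,M,a,b)`, in the variable `t = q^{1/2}` (so base-`q`
Gaussian binomials use `t^2`):
`T(L,M,a,b) = Σ_{n=0, n+a+L even}^{L} q^{n²/2} [M choose n][M+b+(L-a-n)/2 choose M+b]
[M-b+(L+a-n)/2 choose M-b]`. -/
def Trf (t : K) (L M a b : ℤ) : K :=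
  ∑ n ∈ Finset.range (L.toNat + 1),
    if Even ((n : ℤ) + a + L) then
      t ^ ((n : ℤ) ^ 2) * gb (t ^ 2) M n * gb (t ^ 2) (M + b + (L - a - n) / 2) (M + b) *
        gb (t ^ 2) (M - b + (L + a - n) / 2) (M - b)
    else 0

/-- The refined q-trinomial
`S(L,M,a,b) = Σ_{k=0}^L p^{k(k+a)} [L+M-a-2k choose M][M-a+b choose k][M+a-b choose k+a]`. -/
def Sr (p : K) (L M a b : ℤ) : K :=
  ∑ k ∈ Finset.range (L.toNat + 1),
    p ^ ((k : ℤ) * ((k : ℤ) + a)) * gb p (L + M - a - 2 * k) M * gb p (M - a + b) k *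
      gb p (M + a - b) ((k : ℤ) + a)

/-- The `q`-factorial `(q; q)_n`, equal to `1` for negative `n`. -/
def qfac {F : Type*} [Field F] (q : F) (n : ℤ) : F :=
  ∏ i ∈ range n.toNat, (1 - q ^ (i + 1))

/-- The reciprocal `1 / (q; q)_n`, equal to `0` for negative `n`. -/
def qinv {F : Type*} [Field F] (q : F) (n : ℤ) : F :=
  if 0 ≤ n then (qfac q n)⁻¹ else 0

/-- The product `∏_{i < n} (q ^ i - y)`. -/
def qdiff {F : Type*} [Field F] (q y : F) (n : ℕ) : F :=
  ∏ i ∈ range n, (q ^ i - y)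

section QSeries

variable {F : Type*} [Field F] {q : F}

lemma qfac_ne_zero (hq : ∀ n : ℕ, q ^ (n + 1) ≠ 1) (n : ℤ) : qfac q n ≠ 0 :=
  prod_ne_zero_iff.mpr fun i _ => sub_ne_zero.mpr (hq i).symm

lemma qfac_zero : qfac q 0 = 1 := by simp [qfac]

lemma qinv_zero : qinv q 0 = 1 := by simp [qinv, qfac_zero]

lemma qinv_of_neg {n : ℤ} (hn : n < 0) : qinv q n = 0 := if_neg (not_le.mpr hn)

lemma qfac_mul_qinv (hq : ∀ n : ℕ, q ^ (n + 1) ≠ 1) {n : ℤ} (hn : 0 ≤ n) :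
    qfac q n * qinv q n = 1 := by
  rw [qinv, if_pos hn, mul_inv_cancel₀ (qfac_ne_zero hq n)]

lemma qfac_add_one {n : ℤ} (hn : 0 ≤ n) :
    qfac q (n + 1) = qfac q n * (1 - q ^ (n + 1)) := by
  lift n to ℕ using hn
  have h : ((n : ℤ) + 1).toNat = n + 1 := by omega
  rw [qfac, h, prod_range_succ, qfac, Int.toNat_natCast]
  norm_cast

lemma qinv_eq_mul (hq : ∀ n : ℕ, q ^ (n + 1) ≠ 1) (n : ℤ) :
    qinv q n = qinv q (n + 1) * (1 - q ^ (n + 1)) := by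
  rcases lt_trichotomy n (-1) with hn | rfl | hn
  · rw [qinv_of_neg (by omega), qinv_of_neg (by omega), zero_mul]
  · rw [qinv_of_neg (by omega)]
    simp
  · have h0 : 0 ≤ n := by omega
    have h1 := qfac_mul_qinv hq h0
    have h2 := qfac_mul_qinv hq (n := n + 1) (by omega)
    rw [qfac_add_one h0] at h2
    linear_combination qinv q n * (-h2) + (qinv q (n + 1) * (1 - q ^ (n + 1))) * h1

lemma prod_one_sub_zpow (hq : ∀ n : ℕ, q ^ (n + 1) ≠ 1) (hq0 : q ≠ 0) (c : ℤ) (n : ℕ)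
    (h : 0 ≤ c + n) :
    ∏ i ∈ range n, (1 - q ^ (c + 1) * q ^ i) = qfac q (c + n) * qinv q c := by
  induction n generalizing c with
  | zero =>
    have hc : 0 ≤ c := by simpa using h
    simpa using (qfac_mul_qinv hq hc).symm
  | succ n ih =>
    have h' := ih (c + 1) (by push_cast at h; linarith)
    rw [prod_range_succ']
    have e : ∀ i : ℕ, q ^ (c + 1) * q ^ (i + 1) = q ^ (c + 1 + 1) * q ^ i := fun i => by
      rw [zpow_add_one₀ hq0 (c + 1), pow_succ']
      ring
    simp only [e, h']
    rw [qinv_eq_mul hq c, show c + 1 + (n : ℤ) = c + (n + 1 : ℕ) by push_cast; ring]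
    ring

lemma prod_Ico_one_sub_zpow (hq : ∀ n : ℕ, q ^ (n + 1) ≠ 1) (hq0 : q ≠ 0) {c : ℤ} {s n : ℕ}
    (hsn : s ≤ n) (h : 0 ≤ c) :
    ∏ i ∈ Ico s n, (1 - q ^ (c + 1) * q ^ i) = qfac q (c + n) * qinv q (c + s) := by
  rw [prod_Ico_eq_prod_range]
  have e : ∀ i : ℕ, q ^ (c + 1) * q ^ (s + i) = q ^ (c + s + 1) * q ^ i := fun i => by
    rw [pow_add, ← mul_assoc, ← zpow_natCast q s, ← zpow_add₀ hq0]
    ring_nf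
  simp only [e]
  rw [prod_one_sub_zpow hq hq0 _ _ (by omega)]
  congr 2
  omega

lemma qdiff_succ (y : F) (n : ℕ) : qdiff q y (n + 1) = qdiff q y n * (q ^ n - y) :=
  prod_range_succ _ _

lemma qdiff_zpow (hq : ∀ n : ℕ, q ^ (n + 1) ≠ 1) (hq0 : q ≠ 0) {N : ℤ} (hN : 0 ≤ N) (k : ℕ) :
    qdiff q (q ^ N) k = q ^ (k.choose 2) * qfac q N * qinv q (N - k) := by
  induction k with
  | zero => simp [qdiff, qfac_mul_qinv hq hN]
  | succ k ih =>
    rw [qdiff_succ, ih, Nat.choose_succ_succ' k 1, Nat.choose_one_right,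
      show N - (k + 1 : ℕ) = N - k - 1 by push_cast; ring, qinv_eq_mul hq (N - k - 1),
      sub_add_cancel, pow_add]
    have : q ^ N = q ^ k * q ^ (N - k) := by
      rw [← zpow_natCast q k, ← zpow_add₀ hq0]
      ring_nf
    rw [this]
    ring

/-- A polynomial form of the `q`-Pfaff–Saalschütz sum. -/
theorem sum_qPfaffSaalschutz (hq : ∀ n : ℕ, q ^ (n + 1) ≠ 1) (x y z : F) (A : ℕ) :
    ∑ s ∈ range (A + 1), qfac q A * qinv q s * qinv q (A - s) * (x ^ s * qdiff q y s *
      qdiff q z s * (∏ i ∈ Ico s A, (1 - x * q ^ i)) *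
      ∏ i ∈ range (A - s), (1 - x * y * z * q ^ i)) =
    (∏ i ∈ range A, (1 - x * y * q ^ i)) * ∏ i ∈ range A, (1 - x * z * q ^ i) := by
  set U : ℕ → ℕ → F := fun A s => x ^ s * qdiff q y s * qdiff q z s *
    (∏ i ∈ Ico s A, (1 - x * q ^ i)) * ∏ i ∈ range (A - s), (1 - x * y * z * q ^ i) with hU
  change ∑ s ∈ range (A + 1), qfac q A * qinv q s * qinv q (A - s) * U A s = _
  have U_succ_left : ∀ A s, s ≤ A →
      U (A + 1) s = U A s * ((1 - x * q ^ A) * (1 - x * y * z * q ^ (A - s))) := by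
    intro A s hs
    simp only [hU]
    rw [prod_Ico_succ_top hs, Nat.succ_sub hs, prod_range_succ]
    ring
  have U_step : ∀ A s, s + 1 ≤ A → U A s * (x * (q ^ s - y) * (q ^ s - z)) =
      U A (s + 1) * ((1 - x * q ^ s) * (1 - x * y * z * q ^ (A - (s + 1)))) := by
    intro A s hs
    simp only [hU]
    rw [prod_eq_prod_Ico_succ_bot hs, show A - s = A - (s + 1) + 1 by omega, prod_range_succ,
      qdiff_succ, qdiff_succ, pow_succ]
    ring
  induction A with
  | zero => simp [hU, qdiff, qfac_zero, qinv_zero]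
  | succ A ih =>
    have tele : ∀ m, m ≤ A → ∑ s ∈ range (m + 1),
        (qfac q (A + 1) * qinv q s * qinv q (A + 1 - s) * U (A + 1) s -
          (1 - x * y * q ^ A) * (1 - x * z * q ^ A) *
          (qfac q A * qinv q s * qinv q (A - s) * U A s)) =
        -(q ^ (A - m) * (qfac q A * qinv q m * qinv q (A - m)) *
          (U A m * (x * (q ^ m - y) * (q ^ m - z)))) := by
      intro m
      induction m with
      | zero =>
        intro _
        have h1 := qfac_mul_qinv hq (n := A) (by omega)
        have h2 := qfac_mul_qinv hq (n := A + 1) (by omega)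
        simp only [zero_add, sum_range_one, U_succ_left A 0 (Nat.zero_le _), Nat.cast_zero,
          sub_zero, qinv_zero, mul_one, h1, h2, Nat.sub_zero, pow_zero]
        ring
      | succ m ihm =>
        intro hm
        rw [sum_range_succ, ihm (by omega), U_step A m hm, U_succ_left A (m + 1) hm]
        obtain ⟨d, rfl⟩ := Nat.exists_eq_add_of_le hm
        have e1 : qinv q m = qinv q ((m + 1 : ℕ) : ℤ) * (1 - q * q ^ m) := by
          rw [qinv_eq_mul hq]
          norm_cast
          rw [pow_succ']
        have e2 : qinv q (((m + 1 + d : ℕ) : ℤ) - ((m + 1 : ℕ) : ℤ)) =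
            qinv q ((d : ℤ) + 1) * (1 - q * q ^ d) := by
          rw [show ((m + 1 + d : ℕ) : ℤ) - ((m + 1 : ℕ) : ℤ) = d by push_cast; ring,
            qinv_eq_mul hq]
          norm_cast
          rw [pow_succ']
        have e3 : qfac q (((m + 1 + d : ℕ) : ℤ) + 1) =
            qfac q ((m + 1 + d : ℕ) : ℤ) * (1 - q ^ 2 * q ^ m * q ^ d) := by
          rw [qfac_add_one (by omega)]
          norm_cast
          ring
        rw [e1, e2, e3, show ((m + 1 + d : ℕ) : ℤ) - (m : ℤ) = d + 1 by push_cast; ring,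
          show ((m + 1 + d : ℕ) : ℤ) + 1 - ((m + 1 : ℕ) : ℤ) = d + 1 by push_cast; ring,
          show m + 1 + d - m = d + 1 by omega, show m + 1 + d - (m + 1) = d by omega]
        ring
    have h := tele A le_rfl
    rw [sum_sub_distrib, ← mul_sum, ih] at h
    have h1 := qfac_mul_qinv hq (n := A) (by omega)
    have h2 := qfac_mul_qinv hq (n := A + 1) (by omega)
    rw [sum_range_succ, prod_range_succ, prod_range_succ]
    have hUU : U (A + 1) (A + 1) = U A A * (x * (q ^ A - y) * (q ^ A - z)) := by
      simp only [hU, qdiff_succ, Ico_self, prod_empty, Nat.sub_self, range_zero]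
      ring
    simp only [Nat.sub_self, pow_zero, sub_self, qinv_zero, mul_one, one_mul, h1] at h
    push_cast
    rw [sub_self, qinv_zero, mul_one, h2, hUU]
    linear_combination h

/-- The `q`-Pfaff–Saalschütz sum with the order of the products reversed. -/
theorem sum_qPfaffSaalschutz_reversed (hq : ∀ n : ℕ, q ^ (n + 1) ≠ 1) {v y z : F}
    (hv : v ≠ 0) (hy : y ≠ 0) (hz : z ≠ 0) (A : ℕ) :
    ∑ s ∈ range (A + 1), qfac q A * qinv q s * qinv q (A - s) * (v ^ s * qdiff q y s *
      qdiff q z s * (∏ i ∈ Ico s A, (q ^ i - v * y * z)) * qdiff q v (A - s)) =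
    qdiff q (v * y) A * qdiff q (v * z) A := by
  have h := sum_qPfaffSaalschutz hq (v * y * z)⁻¹ y z A
  have e1 : ∀ i, 1 - (v * y * z)⁻¹ * q ^ i = -(v * y * z)⁻¹ * (q ^ i - v * y * z) := fun i => by
    field_simp; ring
  have e2 : ∀ i, 1 - (v * y * z)⁻¹ * y * z * q ^ i = -v⁻¹ * (q ^ i - v) := fun i => by
    field_simp; ring
  have e3 : ∀ i, 1 - (v * y * z)⁻¹ * y * q ^ i = -(v * z)⁻¹ * (q ^ i - v * z) := fun i => by
    field_simp; ring
  have e4 : ∀ i, 1 - (v * y * z)⁻¹ * z * q ^ i = -(v * y)⁻¹ * (q ^ i - v * y) := fun i => by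
    field_simp; ring
  simp only [e1, e2, e3, e4, prod_mul_distrib, prod_const, card_range, Nat.card_Ico] at h
  have hc : (v ^ 2 * y * z) ^ A * ((-(v * z)⁻¹) ^ A * (-(v * y)⁻¹) ^ A) = 1 := by
    rw [← mul_pow, ← mul_pow]
    convert one_pow A
    field_simp
  have h' := congrArg ((v ^ 2 * y * z) ^ A * ·) h
  simp only [mul_sum] at h'
  unfold qdiff at h' ⊢
  rw [show ∀ p₁ p₂ : F, (v ^ 2 * y * z) ^ A * ((-(v * z)⁻¹) ^ A * p₁ * ((-(v * y)⁻¹) ^ A * p₂)) =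
    (v ^ 2 * y * z) ^ A * ((-(v * z)⁻¹) ^ A * (-(v * y)⁻¹) ^ A) * (p₂ * p₁) by intros; ring, hc,
    one_mul] at h'
  rw [← h']
  refine sum_congr rfl fun s hs => ?_
  obtain ⟨d, rfl⟩ := Nat.exists_eq_add_of_le (Nat.lt_succ_iff.mp (mem_range.mp hs))
  have hs : v ^ s = (v ^ 2 * y * z) ^ (s + d) * ((v * y * z)⁻¹ ^ s * (-(v * y * z)⁻¹) ^ d *
      (-v⁻¹) ^ d) := by
    have h1 : (v ^ 2 * y * z) ^ s * (v * y * z)⁻¹ ^ s = v ^ s := by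
      rw [← mul_pow]
      congr 1
      field_simp
    have h2 : (v ^ 2 * y * z) ^ d * ((-(v * y * z)⁻¹) ^ d * (-v⁻¹) ^ d) = 1 := by
      rw [← mul_pow, ← mul_pow]
      convert one_pow d
      field_simp
    rw [pow_add, ← h1]
    linear_combination -((v ^ 2 * y * z) ^ s * (v * y * z)⁻¹ ^ s) * h2
  rw [Nat.add_sub_cancel_left, hs]
  ring

lemma two_mul_choose_two (n : ℕ) : 2 * (n.choose 2 : ℤ) = n * (n - 1) := by
  induction n with
  | zero => simp
  | succ n ih =>
    rw [Nat.choose_succ_succ' n 1, Nat.choose_one_right]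
    push_cast
    linear_combination ih

lemma prod_Ico_sub_zpow (hq : ∀ n : ℕ, q ^ (n + 1) ≠ 1) (hq0 : q ≠ 0) {N : ℤ} {k j : ℕ}
    (hkj : k ≤ j) (hN : k ≤ N) :
    q ^ (k.choose 2) * ∏ i ∈ Ico k j, (q ^ i - q ^ N) =
      q ^ (j.choose 2) * qfac q (N - k) * qinv q (N - j) := by
  have hN0 : 0 ≤ N := by omega
  have h : qdiff q (q ^ N) k * ∏ i ∈ Ico k j, (q ^ i - q ^ N) = qdiff q (q ^ N) j :=
    prod_range_mul_prod_Ico _ hkj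
  rw [qdiff_zpow hq hq0 hN0, qdiff_zpow hq hq0 hN0] at h
  have h1 := qfac_mul_qinv hq (n := N - k) (by omega)
  refine mul_left_cancel₀ (qfac_ne_zero hq N) ?_
  linear_combination qfac q (N - k) * h -
    qfac q N * q ^ (k.choose 2) * (∏ i ∈ Ico k j, (q ^ i - q ^ N)) * h1

lemma sum_qdiff_qPfaffSaalschutz (hq : ∀ n : ℕ, q ^ (n + 1) ≠ 1) (hq0 : q ≠ 0) (A : ℕ)
    {B C c : ℤ} (hB : 0 ≤ B) (hc : 0 ≤ c) (hBC : 0 ≤ B + C + c) (hAC : 0 ≤ A + C + c) :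
    ∑ s ∈ range (A + 1), q ^ ((s : ℤ) * (s + c)) * (q ^ (s.choose 2))⁻¹ * qdiff q (q ^ C) s *
      qfac q (A + B + C + c - s) * qinv q s * qinv q (s + c) * qinv q (A - s) * qinv q (B - s) =
    qfac q (A + B + c) * qfac q (A + C + c) * qfac q (B + C + c) * qinv q A * qinv q B *
      qinv q (A + c) * qinv q (B + c) * qinv q (C + c) := by
  have h := sum_qPfaffSaalschutz hq (q ^ (c + 1)) (q ^ B) (q ^ C) A
  have e1 : q ^ (c + 1) * q ^ B = q ^ (B + c + 1) := by
    rw [← zpow_add₀ hq0]; ring_nf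
  have e2 : q ^ (c + 1) * q ^ C = q ^ (C + c + 1) := by
    rw [← zpow_add₀ hq0]; ring_nf
  have e3 : q ^ (B + c + 1) * q ^ C = q ^ (B + C + c + 1) := by
    rw [← zpow_add₀ hq0]; ring_nf
  rw [e1, e2, e3, prod_one_sub_zpow hq hq0 _ _ (by omega),
    prod_one_sub_zpow hq hq0 _ _ (by omega)] at h
  have hA := qfac_mul_qinv hq (n := A) (by omega)
  have hB' := qfac_mul_qinv hq hB
  have hAc := qfac_mul_qinv hq (n := A + c) (by omega)
  have hX := qfac_mul_qinv hq hBC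
  rw [show (A : ℤ) + B + c = B + c + A by ring, show (A : ℤ) + C + c = C + c + A by ring]
  have h' := congrArg (qinv q A * qinv q B * qinv q (A + c) * qfac q (B + C + c) * ·) h
  simp only [mul_sum] at h'
  refine (sum_congr rfl fun s hs => ?_).trans (h'.trans ?_)
  · have hs : s ≤ A := Nat.lt_succ_iff.mp (mem_range.mp hs)
    rw [prod_Ico_one_sub_zpow hq hq0 hs hc, prod_one_sub_zpow hq hq0 _ _ (by omega),
      qdiff_zpow hq hq0 hB]
    have hp : q ^ ((s : ℤ) * (s + c)) * (q ^ (s.choose 2))⁻¹ =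
        (q ^ (c + 1)) ^ s * q ^ (s.choose 2) := by
      simp only [← zpow_natCast, ← zpow_mul, ← zpow_neg, ← zpow_add₀ hq0]
      congr 1
      linear_combination -(two_mul_choose_two s)
    rw [hp, show (A : ℤ) + B + C + c - s = B + C + c + (A - s : ℕ) by push_cast [hs]; ring,
      add_comm (s : ℤ) c, add_comm (A : ℤ) c]
    rw [add_comm (A : ℤ) c] at hAc
    have hP : qfac q A * qinv q A * (qfac q B * qinv q B) * (qfac q (c + A) * qinv q (c + A)) *
        (qfac q (B + C + c) * qinv q (B + C + c)) = 1 := by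
      rw [hA, hB', hAc, hX]
      ring
    linear_combination -((q ^ (c + 1)) ^ s * q ^ (s.choose 2) * qdiff q (q ^ C) s *
      qfac q (B + C + c + (A - s : ℕ)) * qinv q s * qinv q (c + s) * qinv q (A - s) *
      qinv q (B - s)) * hP
  · ring

lemma sum_saalschutz (hq : ∀ n : ℕ, q ^ (n + 1) ≠ 1) (hq0 : q ≠ 0) (A : ℕ)
    {B C c : ℤ} (hB : 0 ≤ B) (hC : 0 ≤ C) (hc : 0 ≤ c) :
    ∑ s ∈ range (A + 1), q ^ ((s : ℤ) * (s + c)) * qfac q (A + B + C + c - s) * qinv q s *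
      qinv q (s + c) * qinv q (A - s) * qinv q (B - s) * qinv q (C - s) =
    qfac q (A + B + c) * qfac q (A + C + c) * qfac q (B + C + c) * qinv q A * qinv q B *
      qinv q C * qinv q (A + c) * qinv q (B + c) * qinv q (C + c) := by
  have h := sum_qdiff_qPfaffSaalschutz hq hq0 A (C := C) hB hc (by omega) (by omega)
  have h1 := qfac_mul_qinv hq hC
  have h' := congrArg (qinv q C * ·) h
  simp only [mul_sum] at h'
  refine (sum_congr rfl fun s _ => ?_).trans (h'.trans ?_)
  · rw [qdiff_zpow hq hq0 hC]
    have h2 : (q ^ (s.choose 2))⁻¹ * q ^ (s.choose 2) = 1 :=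
      inv_mul_cancel₀ (pow_ne_zero _ hq0)
    linear_combination -(q ^ ((s : ℤ) * (s + c)) * qfac q (A + B + C + c - s) * qinv q s *
      qinv q (s + c) * qinv q (A - s) * qinv q (B - s) * qinv q (C - s)) *
      (qfac q C * qinv q C * h2 + h1)
  · ring

lemma sum_saalschutz_reversed (hq : ∀ n : ℕ, q ^ (n + 1) ≠ 1) (hq0 : q ≠ 0) {j : ℕ}
    {X Y Z : ℤ} (hY : 0 ≤ Y) (hZ : 0 ≤ Z) (hXY : 0 ≤ X + Y) (hXZ : 0 ≤ X + Z)
    (hj : j ≤ X + Y + Z) :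
    ∑ k ∈ range (j + 1), (q ^ X) ^ k * q ^ (k.choose 2) * (q ^ (j.choose 2))⁻¹ *
      qdiff q (q ^ X) (j - k) * qfac q (X + Y + Z - k) * qinv q k * qinv q (j - k) *
      qinv q (Y - k) * qinv q (Z - k) =
    qfac q (X + Y + Z - j) * qinv q (X + Y - j) * qinv q (X + Z - j) * qfac q (X + Y) *
      qfac q (X + Z) * qinv q Y * qinv q Z * qinv q j := by
  have h := sum_qPfaffSaalschutz_reversed hq (zpow_ne_zero X hq0) (zpow_ne_zero Y hq0)
    (zpow_ne_zero Z hq0) j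
  rw [← zpow_add₀ hq0, ← zpow_add₀ hq0, ← zpow_add₀ hq0, qdiff_zpow hq hq0 hXY,
    qdiff_zpow hq hq0 hXZ] at h
  have h1 := qfac_mul_qinv hq hY
  have h2 := qfac_mul_qinv hq hZ
  have h3 := qfac_mul_qinv hq (n := j) (by omega)
  have h4 := qfac_mul_qinv hq (n := X + Y + Z - j) (by omega)
  have h5 : (q ^ (j.choose 2))⁻¹ * q ^ (j.choose 2) = 1 := inv_mul_cancel₀ (pow_ne_zero _ hq0)
  have h' := congrArg (qfac q (X + Y + Z - j) * qinv q Y * qinv q Z * qinv q j *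
    ((q ^ (j.choose 2))⁻¹ * (q ^ (j.choose 2))⁻¹) * ·) h
  simp only [mul_sum] at h'
  refine (sum_congr rfl fun k hk => ?_).trans (h'.trans ?_)
  · have hk : k ≤ j := Nat.lt_succ_iff.mp (mem_range.mp hk)
    have hI := prod_Ico_sub_zpow hq hq0 hk (N := X + Y + Z) (by omega)
    rw [qdiff_zpow hq hq0 hY, qdiff_zpow hq hq0 hZ]
    have hP : (qfac q Y * qinv q Y) * (qfac q Z * qinv q Z) * (qfac q j * qinv q j) *
        (qfac q (X + Y + Z - j) * qinv q (X + Y + Z - j)) *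
        ((q ^ (j.choose 2))⁻¹ * q ^ (j.choose 2)) = 1 := by
      rw [h1, h2, h3, h4, h5]
      ring
    set c := (q ^ (j.choose 2))⁻¹
    linear_combination -((q ^ X) ^ k * q ^ (k.choose 2) * c *
      qdiff q (q ^ X) (j - k) * qfac q (X + Y + Z - k) * qinv q k * qinv q (j - k) *
      qinv q (Y - k) * qinv q (Z - k)) * hP -
      qfac q (X + Y + Z - j) * qinv q Y * qinv q Z * qinv q j * c * c *
      qfac q j * qinv q k * qinv q (j - k) * (q ^ X) ^ k * q ^ (k.choose 2) * qfac q Y *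
      qinv q (Y - k) * qfac q Z * qinv q (Z - k) * qdiff q (q ^ X) (j - k) * hI
  · linear_combination qfac q (X + Y + Z - j) * qinv q (X + Y - j) * qinv q (X + Z - j) *
      qfac q (X + Y) * qfac q (X + Z) * qinv q Y * qinv q Z * qinv q j *
      ((q ^ (j.choose 2))⁻¹ * q ^ (j.choose 2) + 1) * h5

/-- The double-sum summand of the left-hand side of `T_to_S`. -/
def tSummand (q : F) (L M a b r j : ℤ) : F :=
  q ^ (r * (r + b) + j * (j + b)) * qfac q (L + M - b - r - j) * qinv q L *
    qinv q (M - b - r - j) * qfac q (L - b - r - j) * qinv q (r - j) * qinv q (L - b - 2 * r) *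
    qfac q (L + a - b - r) * qinv q (L + a - b - r - j) * qinv q j * qfac q (L - a - r) *
    qinv q (L - a - b - r - j) * qinv q (j + b)

/-- The result of applying the Sears transformation to the sum of `tSummand` over `j`. -/
def midSummand (q : F) (L M a b r k : ℤ) : F :=
  q ^ (r * (r + b) + k * (k + a - r)) * qfac q (M - a) * qfac q (L + M - b - r - k) *
    qfac q (L - a - k) * qfac q a * qinv q (L - k) * qinv q (M - a - k) * qinv q (M - b - r) *
    qinv q k * qinv q (r - k) * qinv q (L - a - b - r - k) * qinv q (b + r) * qinv q (a - r + k)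

/-- The summand of `S(L, M, a + b, b)`. -/
def sSummand (q : F) (L M a b k : ℤ) : F :=
  q ^ (k * (k + a + b)) * qfac q (L + M - a - b - 2 * k) * qinv q M *
    qinv q (L - a - b - 2 * k) * qfac q (M - a) * qinv q k * qinv q (M - a - k) *
    qfac q (M + a) * qinv q (k + a + b) * qinv q (M - b - k)

lemma choose_two_add (k m : ℕ) : (k + m).choose 2 = k.choose 2 + m.choose 2 + k * m := by
  have h1 := two_mul_choose_two k
  have h2 := two_mul_choose_two m
  have h3 := two_mul_choose_two (k + m)
  zify
  push_cast at h3
  refine mul_left_cancel₀ two_ne_zero ?_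
  linear_combination h3 - h1 - h2

/-- A case of the Sears transformation of terminating balanced `₄φ₃` series. -/
lemma sum_tSummand (hq : ∀ n : ℕ, q ^ (n + 1) ≠ 1) (hq0 : q ≠ 0) {L M a b r : ℕ} (ha : a ≤ M) :
    ∑ j ∈ range (r + 1), tSummand q L M a b r j =
      ∑ k ∈ range (r + 1), midSummand q L M a b r k := by
  by_cases hM : b + r ≤ M; swap
  · rw [sum_eq_zero, sum_eq_zero]
    · intro k _
      rw [midSummand, qinv_of_neg (n := M - b - r) (by omega)]
      ring
    · intro j _
      rw [tSummand, qinv_of_neg (n := M - b - r - j) (by omega)]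
      ring
  by_cases hL : b + 2 * r ≤ L; swap
  · rw [sum_eq_zero, sum_eq_zero]
    · intro k _
      rw [midSummand]
      rcases lt_or_ge ((a : ℤ) - r + k) 0 with h | h
      · rw [qinv_of_neg h]
        ring
      · rw [qinv_of_neg (n := L - a - b - r - k) (by omega)]
        ring
    · intro j _
      rw [tSummand, qinv_of_neg (n := L - b - 2 * r) (by omega)]
      ring
  set W : ℕ → ℕ → F := fun k m =>
    q ^ ((r : ℤ) * (r + b) + (k + m : ℕ) * ((k + m : ℕ) + b)) *
    qfac q (L - b - r - (k + m : ℕ)) * qinv q (r - (k + m : ℕ)) * qinv q (L - b - 2 * r) *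
    qfac q (L - a - r) * qinv q (L - a - b - r - (k + m : ℕ)) * qinv q ((k + m : ℕ) + b) *
    qfac q (M - a) * qinv q (M - b - r) *
    ((q ^ ((a : ℤ) - b - r)) ^ k * q ^ (k.choose 2) * (q ^ ((k + m).choose 2))⁻¹ *
      qdiff q (q ^ ((a : ℤ) - b - r)) m * qfac q (L + M - b - r - k) * qinv q k * qinv q m *
      qinv q (M - a - k) * qinv q (L - k)) with hW
  have h1 : ∀ j ∈ range (r + 1), tSummand q L M a b r j = ∑ k ∈ range (j + 1), W k (j - k) := by
    intro j hj
    have hj : j ≤ r := Nat.lt_succ_iff.mp (mem_range.mp hj)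
    have h := sum_saalschutz_reversed hq hq0 (j := j) (X := a - b - r) (Y := M - a) (Z := L)
      (by omega) (by omega) (by omega) (by omega) (by omega)
    rw [show (a : ℤ) - b - r + (M - a) + L = L + M - b - r by ring,
      show (a : ℤ) - b - r + (M - a) = M - b - r by ring,
      show (a : ℤ) - b - r + L = L + a - b - r by ring] at h
    have h' := congrArg (q ^ ((r : ℤ) * (r + b) + j * (j + b)) *
      qfac q (L - b - r - j) * qinv q (r - j) * qinv q (L - b - 2 * r) *
      qfac q (L - a - r) * qinv q (L - a - b - r - j) * qinv q (j + b) *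
      qfac q (M - a) * qinv q (M - b - r) * ·) h
    simp only [mul_sum] at h'
    refine Eq.trans ?_ (h'.symm.trans (sum_congr rfl fun k hk => ?_))
    · have e1 := qfac_mul_qinv hq (n := M - a) (by omega)
      have e2 := qfac_mul_qinv hq (n := M - b - r) (by omega)
      have e3 : qfac q ((M : ℤ) - a) * qinv q (M - a) * (qfac q (M - b - r) * qinv q (M - b - r)) =
        1 := by rw [e1, e2, one_mul]
      rw [tSummand]
      linear_combination -(q ^ ((r : ℤ) * (r + b) + j * (j + b)) * qfac q (L + M - b - r - j) *
        qinv q L * qinv q (M - b - r - j) * qfac q (L - b - r - j) * qinv q (r - j) *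
        qinv q (L - b - 2 * r) * qfac q (L + a - b - r) * qinv q (L + a - b - r - j) * qinv q j *
        qfac q (L - a - r) * qinv q (L - a - b - r - j) * qinv q (j + b)) * e3
    · have hk : k ≤ j := Nat.lt_succ_iff.mp (mem_range.mp hk)
      simp only [hW]
      rw [Nat.add_sub_cancel' hk, Nat.cast_sub hk]
  have h2 : ∀ k ∈ range (r + 1), ∑ m ∈ range (r + 1 - k), W k m = midSummand q L M a b r k := by
    intro k hk
    have hk : k ≤ r := Nat.lt_succ_iff.mp (mem_range.mp hk)
    by_cases hB : a + b + r + k ≤ L; swap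
    · rw [midSummand, qinv_of_neg (n := L - a - b - r - k) (by omega), sum_eq_zero]
      · ring
      · intro m _
        simp only [hW]
        rw [qinv_of_neg (n := L - a - b - r - (k + m : ℕ)) (by omega)]
        ring
    have h := sum_qdiff_qPfaffSaalschutz hq hq0 (r - k) (B := L - a - b - r - k) (C := a - b - r)
      (c := b + k) (by omega) (by omega) (by omega) (by omega)
    rw [Nat.cast_sub hk,
      show (r : ℤ) - k + (L - a - b - r - k) + (b + k) = L - a - k by ring,
      show (r : ℤ) - k + (a - b - r) + (b + k) = a by ring,
      show (L : ℤ) - a - b - r - k + (a - b - r) + (b + k) = L - b - 2 * r by ring,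
      show (r : ℤ) - k + (b + k) = b + r by ring,
      show (L : ℤ) - a - b - r - k + (b + k) = L - a - r by ring,
      show (a : ℤ) - b - r + (b + k) = a - r + k by ring] at h
    have h' := congrArg (q ^ ((r : ℤ) * (r + b) + k * (k + a - r)) * qinv q (L - b - 2 * r) *
      qfac q (L - a - r) * qfac q (M - a) * qinv q (M - b - r) * qfac q (L + M - b - r - k) *
      qinv q k * qinv q (M - a - k) * qinv q (L - k) * ·) h
    simp only [mul_sum] at h'
    rw [show r + 1 - k = r - k + 1 by omega]
    refine (sum_congr rfl fun m _ => ?_).trans (h'.trans ?_)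
    · simp only [hW]
      have hp : q ^ ((r : ℤ) * (r + b) + (k + m : ℕ) * ((k + m : ℕ) + b)) *
          ((q ^ ((a : ℤ) - b - r)) ^ k * q ^ (k.choose 2) * (q ^ ((k + m).choose 2))⁻¹) =
          q ^ ((r : ℤ) * (r + b) + k * (k + a - r)) *
          (q ^ ((m : ℤ) * (m + (b + k))) * (q ^ (m.choose 2))⁻¹) := by
        rw [choose_two_add]
        simp only [← zpow_natCast, ← zpow_mul, ← zpow_neg, ← zpow_add₀ hq0]
        congr 1
        push_cast
        ring
      rw [show (L : ℤ) - b - r - (k + m : ℕ) = r - k + (L - a - b - r - k) + (a - b - r) +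
          (b + k) - m by push_cast; ring,
        show (r : ℤ) - (k + m : ℕ) = r - k - m by push_cast; ring,
        show (L : ℤ) - a - b - r - (k + m : ℕ) = L - a - b - r - k - m by push_cast; ring,
        show ((k + m : ℕ) : ℤ) + b = m + (b + k) by push_cast; ring]
      rw [show ((k + m : ℕ) : ℤ) + b = m + (b + k) by push_cast; ring] at hp
      linear_combination qfac q (r - k + (L - a - b - r - k) + (a - b - r) + (b + k) - m) *
        qinv q (r - k - m) * qinv q (L - b - 2 * r) * qfac q (L - a - r) *
        qinv q (L - a - b - r - k - m) * qinv q (m + (b + k)) * qfac q (M - a) *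
        qinv q (M - b - r) * qdiff q (q ^ ((a : ℤ) - b - r)) m * qfac q (L + M - b - r - k) *
        qinv q k * qinv q m * qinv q (M - a - k) * qinv q (L - k) * hp
    · have e1 := qfac_mul_qinv hq (n := L - b - 2 * r) (by omega)
      have e2 := qfac_mul_qinv hq (n := L - a - r) (by omega)
      have e3 : qfac q ((L : ℤ) - b - 2 * r) * qinv q (L - b - 2 * r) *
          (qfac q (L - a - r) * qinv q (L - a - r)) = 1 := by rw [e1, e2, one_mul]
      rw [midSummand]
      linear_combination (q ^ ((r : ℤ) * (r + b) + k * (k + a - r)) * qfac q (M - a) *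
        qfac q (L + M - b - r - k) * qfac q (L - a - k) * qfac q a * qinv q (L - k) *
        qinv q (M - a - k) * qinv q (M - b - r) * qinv q k * qinv q (r - k) *
        qinv q (L - a - b - r - k) * qinv q (b + r) * qinv q (a - r + k)) * e3
  rw [sum_congr rfl h1, sum_range_diag_flip (r + 1) W, sum_congr rfl h2]

lemma sum_midSummand (hq : ∀ n : ℕ, q ^ (n + 1) ≠ 1) (hq0 : q ≠ 0) (L M a b k : ℕ) :
    ∑ s ∈ range (L + 1 - k), midSummand q L M a b (k + s : ℕ) k = sSummand q L M a b k := by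
  by_cases hB : a + b + 2 * k ≤ L; swap
  · rw [sSummand, qinv_of_neg (n := L - a - b - 2 * k) (by omega), sum_eq_zero]
    · ring
    · intro s _
      rw [midSummand, qinv_of_neg (n := L - a - b - (k + s : ℕ) - k) (by omega)]
      ring
  by_cases hC : b + k ≤ M; swap
  · rw [sSummand, qinv_of_neg (n := M - b - k) (by omega), sum_eq_zero]
    · ring
    · intro s _
      rw [midSummand, qinv_of_neg (n := M - b - (k + s : ℕ)) (by omega)]
      ring
  have hsub : range (a + 1) ⊆ range (L + 1 - k) := range_subset_range.mpr (by omega)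
  rw [← sum_subset hsub]
  · have h := sum_saalschutz hq hq0 a (B := M - b - k) (C := L - a - b - 2 * k) (c := b + k)
      (by omega) (by omega) (by omega)
    rw [show (a : ℤ) + (M - b - k) + (b + k) = M + a by ring,
      show (a : ℤ) + (L - a - b - 2 * k) + (b + k) = L - k by ring,
      show (M : ℤ) - b - k + (L - a - b - 2 * k) + (b + k) = L + M - a - b - 2 * k by ring,
      show (a : ℤ) + (b + k) = k + a + b by ring,
      show (M : ℤ) - b - k + (b + k) = M by ring,
      show (L : ℤ) - a - b - 2 * k + (b + k) = L - a - k by ring] at h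
    have h' := congrArg (q ^ ((k : ℤ) * (k + a + b)) * qfac q (M - a) * qfac q (L - a - k) *
      qfac q a * qinv q (L - k) * qinv q (M - a - k) * qinv q k * ·) h
    simp only [mul_sum] at h'
    refine (sum_congr rfl fun s _ => ?_).trans (h'.trans ?_)
    · rw [midSummand]
      have hp : q ^ (((k + s : ℕ) : ℤ) * ((k + s : ℕ) + b) + k * (k + a - (k + s : ℕ))) =
          q ^ ((k : ℤ) * (k + a + b)) * q ^ ((s : ℤ) * (s + (b + k))) := by
        rw [← zpow_add₀ hq0]
        congr 1
        push_cast
        ring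
      rw [hp, show (L : ℤ) + M - b - (k + s : ℕ) - k = a + (M - b - k) + (L - a - b - 2 * k) +
          (b + k) - s by push_cast; ring,
        show (M : ℤ) - b - (k + s : ℕ) = M - b - k - s by push_cast; ring,
        show ((k + s : ℕ) : ℤ) - k = s by push_cast; ring,
        show (L : ℤ) - a - b - (k + s : ℕ) - k = L - a - b - 2 * k - s by push_cast; ring,
        show (b : ℤ) + (k + s : ℕ) = s + (b + k) by push_cast; ring,
        show (a : ℤ) - (k + s : ℕ) + k = a - s by push_cast; ring]
      ring
    · have e1 := qfac_mul_qinv hq (n := a) (by omega)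
      have e2 := qfac_mul_qinv hq (n := L - k) (by omega)
      have e3 := qfac_mul_qinv hq (n := L - a - k) (by omega)
      have e4 : qfac q (a : ℤ) * qinv q a * (qfac q (L - k) * qinv q (L - k)) *
          (qfac q (L - a - k) * qinv q (L - a - k)) = 1 := by rw [e1, e2, e3, one_mul, one_mul]
      rw [sSummand]
      linear_combination (q ^ ((k : ℤ) * (k + a + b)) * qfac q (L + M - a - b - 2 * k) * qinv q M *
        qinv q (L - a - b - 2 * k) * qfac q (M - a) * qinv q k * qinv q (M - a - k) *
        qfac q (M + a) * qinv q (k + a + b) * qinv q (M - b - k)) * e4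
  · intro s _ hs
    rw [mem_range] at hs
    rw [midSummand, qinv_of_neg (n := a - (k + s : ℕ) + k) (by omega)]
    ring

theorem sum_sum_tSummand (hq : ∀ n : ℕ, q ^ (n + 1) ≠ 1) (hq0 : q ≠ 0) {L M a b : ℕ}
    (ha : a ≤ M) :
    ∑ r ∈ range (L + 1), ∑ j ∈ range (r + 1), tSummand q L M a b r j =
      ∑ k ∈ range (L + 1), sSummand q L M a b k := by
  have h := sum_range_diag_flip (L + 1)
    (fun k s => midSummand q L M a b (k + s : ℕ) k)
  simp only [sum_midSummand hq hq0] at h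
  rw [← h]
  refine sum_congr rfl fun r _ => ?_
  rw [sum_tSummand hq hq0 ha]
  refine sum_congr rfl fun k hk => ?_
  rw [Nat.add_sub_cancel' (Nat.lt_succ_iff.mp (mem_range.mp hk))]

end QSeries

lemma gb_of_neg {n k : ℤ} (p : K) (hk : k < 0) : gb p n k = 0 := if_neg (by omega)

lemma gb_of_lt {n k : ℤ} (p : K) (hk : n < k) : gb p n k = 0 := if_neg (by omega)

lemma gb_eq {q : K} (hq : ∀ n : ℕ, q ^ (n + 1) ≠ 1) (hq0 : q ≠ 0) (n k : ℤ) :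
    gb q n k = qfac q n * qinv q k * qinv q (n - k) := by
  rcases lt_or_ge k 0 with hk | hk
  · rw [gb_of_neg q hk, qinv_of_neg hk]
    ring
  rcases lt_or_ge n k with hn | hn
  · rw [gb_of_lt q hn, qinv_of_neg (n := n - k) (by omega)]
    ring
  have h1 : ∀ j : ℕ, q ^ (n - k + 1 + (j : ℤ)) = q ^ (n - k + 1) * q ^ j := fun j => by
    rw [zpow_add₀ hq0, zpow_natCast]
  have h2 : ∀ j : ℕ, q ^ (1 + (j : ℤ)) = q ^ (j + 1) := fun j => by
    rw [← zpow_natCast]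
    push_cast
    ring_nf
  have h3 : qinv q k = (qfac q k)⁻¹ := if_pos hk
  rw [gb, if_pos ⟨hk, hn⟩, prod_div_distrib]
  simp only [h1, h2]
  rw [prod_one_sub_zpow hq hq0 _ _ (by omega), Int.toNat_of_nonneg hk, sub_add_cancel,
    ← qfac, div_eq_mul_inv, mul_right_comm, h3]

lemma tq_ne_zero : tq ≠ 0 := RatFunc.X_ne_zero

lemma tq_pow_ne_one {n : ℕ} (hn : n ≠ 0) : tq ^ n ≠ 1 := by
  intro h
  rw [tq, ← RatFunc.algebraMap_X, ← map_pow, ← map_one (algebraMap (Polynomial ℚ) K)] at h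
  have h' := congrArg Polynomial.natDegree (RatFunc.algebraMap_injective ℚ h)
  simp [hn] at h'

lemma Trf_neg (t : K) (L M a b : ℤ) : Trf t L M (-a) (-b) = Trf t L M a b := by
  refine sum_congr rfl fun n _ => ?_
  have he : Even ((n : ℤ) + -a + L) ↔ Even ((n : ℤ) + a + L) := by
    simp only [Int.even_add, even_neg]
  simp only [he]
  split_ifs
  · rw [sub_neg_eq_add, sub_neg_eq_add, ← sub_eq_add_neg, ← sub_eq_add_neg, mul_right_comm]
  · rfl

lemma Sr_neg (p : K) (L M : ℕ) (c : ℕ) (b : ℤ) : Sr p L M (-c) (-b) = Sr p L M c b := by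
  symm
  refine sum_bij_ne_zero (fun k _ _ => k + c) ?_ ?_ ?_ ?_
  · intro k _ h
    by_contra hk
    rw [mem_range] at hk
    rw [gb_of_lt (k := (M : ℤ)) p (by omega)] at h
    simp at h
  · intro k _ _ k' _ _ h
    omega
  · intro k hk h
    rw [mem_range] at hk
    rcases lt_or_ge k c with hc | hc
    · rw [gb_of_neg (k := (k : ℤ) + -c) p (by omega)] at h
      simp at h
    · obtain ⟨m, rfl⟩ := Nat.exists_eq_add_of_le' hc
      refine ⟨m, mem_range.mpr (by omega), ?_, rfl⟩
      convert h using 1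
      push_cast
      ring_nf
  · intro k _ _
    push_cast
    ring_nf

lemma sum_gb_mul_Trf {t : K} (hq : ∀ n : ℕ, (t ^ 2) ^ (n + 1) ≠ 1) (ht : t ≠ 0)
    (L M a b : ℕ) :
    ∑ i ∈ range (M + 1), t ^ ((i : ℤ) ^ 2) * gb (t ^ 2) ((L : ℤ) + M - i) L *
      Trf t i ((L : ℤ) - i) b a =
    t ^ ((b : ℤ) ^ 2) *
      ∑ r ∈ range (L + 1), ∑ j ∈ range (r + 1), tSummand (t ^ 2) L M a b r j := by
  have hq0 : t ^ 2 ≠ 0 := pow_ne_zero 2 ht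
  set G : ℕ → ℕ → K := fun i n => t ^ ((i : ℤ) ^ 2) * gb (t ^ 2) ((L : ℤ) + M - i) L *
    if Even ((n : ℤ) + b + i) then t ^ ((n : ℤ) ^ 2) * gb (t ^ 2) (L - i) n *
        gb (t ^ 2) (L - i + a + (i - b - n) / 2) (L - i + a) *
        gb (t ^ 2) (L - i - a + (i + b - n) / 2) (L - i - a) else 0 with hG
  have key : ∀ i n r j : ℕ, i = r + j + b → r = n + j →
      t ^ ((b : ℤ) ^ 2) * tSummand (t ^ 2) L M a b r j = G i n := by
    intro i n r j hi hr
    have hi' : (i : ℤ) = r + j + b := by omega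
    have hn' : (n : ℤ) = r - j := by omega
    have he : Even ((r : ℤ) - j + b + (r + j + b)) := ⟨r + b, by ring⟩
    have hp : t ^ ((r + j + b : ℤ) ^ 2) * t ^ ((r - j : ℤ) ^ 2) =
        t ^ ((b : ℤ) ^ 2) * (t ^ 2) ^ ((r : ℤ) * (r + b) + j * (j + b)) := by
      rw [← zpow_natCast t 2, ← zpow_mul, ← zpow_add₀ ht, ← zpow_add₀ ht]
      congr 1
      push_cast
      ring
    simp only [hG, hi', hn', if_pos he, gb_eq hq hq0, tSummand]
    rw [show ((r : ℤ) + j + b - b - (r - j)) / 2 = j by omega,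
      show ((r : ℤ) + j + b + b - (r - j)) / 2 = j + b by omega,
      show (L : ℤ) + M - (r + j + b) = L + M - b - r - j by ring,
      show (L : ℤ) + M - b - r - j - L = M - b - r - j by ring,
      show (L : ℤ) - (r + j + b) = L - b - r - j by ring,
      show (L : ℤ) - b - r - j - (r - j) = L - b - 2 * r by ring,
      add_sub_cancel_left, add_sub_cancel_left,
      show (L : ℤ) - b - r - j + a + j = L + a - b - r by ring,
      show (L : ℤ) - b - r - j + a = L + a - b - r - j by ring,
      show (L : ℤ) - b - r - j - a + (j + b) = L - a - r by ring,
      show (L : ℤ) - b - r - j - a = L - a - b - r - j by ring]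
    linear_combination -(qfac (t ^ 2) (L + M - b - r - j) * qinv (t ^ 2) L *
      qinv (t ^ 2) (M - b - r - j) * qfac (t ^ 2) (L - b - r - j) * qinv (t ^ 2) (r - j) *
      qinv (t ^ 2) (L - b - 2 * r) * qfac (t ^ 2) (L + a - b - r) *
      qinv (t ^ 2) (L + a - b - r - j) * qinv (t ^ 2) j * qfac (t ^ 2) (L - a - r) *
      qinv (t ^ 2) (L - a - b - r - j) * qinv (t ^ 2) (j + b)) * hp
  have hLHS : ∑ i ∈ range (M + 1), t ^ ((i : ℤ) ^ 2) * gb (t ^ 2) ((L : ℤ) + M - i) L *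
      Trf t i ((L : ℤ) - i) b a = ∑ i ∈ range (M + 1), ∑ n ∈ range (i + 1), G i n := by
    refine sum_congr rfl fun i _ => ?_
    rw [Trf, mul_sum, Int.toNat_natCast]
  rw [hLHS, mul_sum, sum_congr rfl fun r _ => mul_sum _ _ _, sum_sigma', sum_sigma']
  symm
  refine sum_bij_ne_zero (fun x _ _ => ⟨x.1 + x.2 + b, x.1 - x.2⟩) ?_ ?_ ?_ ?_
  · rintro ⟨r, j⟩ hx h
    simp only [mem_sigma, mem_range] at hx ⊢
    refine ⟨?_, by omega⟩
    by_contra hM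
    refine h ?_
    simp only
    rw [tSummand, qinv_of_neg (n := M - b - r - j) (by omega)]
    ring
  · rintro ⟨r, j⟩ hx _ ⟨r', j'⟩ hx' _ h
    simp only [mem_sigma, mem_range, Sigma.mk.injEq, heq_eq_eq] at hx hx' h ⊢
    omega
  · rintro ⟨i, n⟩ hx h
    simp only [mem_sigma, mem_range] at hx
    have he : Even ((n : ℤ) + b + i) := by
      by_contra he
      exact h (by simp only [hG, if_neg he, mul_zero])
    have hn : n + b ≤ i := by
      by_contra hn
      refine h ?_
      simp only [hG]
      rw [if_pos he, gb_of_lt (k := L - i + a) _ (by omega)]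
      ring
    obtain ⟨j, hj⟩ : ∃ j, i = n + b + 2 * j := by
      obtain ⟨c, hc⟩ := he
      exact ⟨(i - n - b) / 2, by omega⟩
    have hG' : t ^ ((b : ℤ) ^ 2) * tSummand (t ^ 2) L M a b (n + j : ℕ) j = G i n :=
      key i n (n + j) j (by omega) rfl
    have hL : n + j ≤ L := by
      by_contra hL
      refine h ?_
      simp only
      rw [← hG', tSummand, qinv_of_neg (n := L - b - 2 * (n + j : ℕ)) (by omega)]
      ring
    refine ⟨⟨n + j, j⟩, ?_, ?_, ?_⟩
    · simp only [mem_sigma, mem_range]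
      omega
    · simp only
      rw [hG']
      exact h
    · simp only [Sigma.mk.injEq, heq_eq_eq]
      omega
  · rintro ⟨r, j⟩ hx _
    simp only [mem_sigma, mem_range] at hx
    exact key (r + j + b) (r - j) r j rfl (by omega)

theorem T_to_S_of_nonneg (L M a b : ℕ) (h : b ≤ M → a + b ≤ L → a ≤ M) :
    ∑ i ∈ range (M + 1), tq ^ ((i : ℤ) ^ 2) * gb (tq ^ 2) ((L : ℤ) + M - i) L *
      Trf tq i ((L : ℤ) - i) b a =
    tq ^ ((b : ℤ) ^ 2) * Sr (tq ^ 2) L M (a + b) b := by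
  have hq : ∀ n : ℕ, (tq ^ 2) ^ (n + 1) ≠ 1 := fun n => by
    rw [← pow_mul]
    exact tq_pow_ne_one (by omega)
  have hq0 : tq ^ 2 ≠ 0 := pow_ne_zero 2 tq_ne_zero
  have hS : Sr (tq ^ 2) L M (a + b) b = ∑ k ∈ range (L + 1), sSummand (tq ^ 2) L M a b k := by
    refine sum_congr rfl fun k _ => ?_
    simp only [gb_eq hq hq0]
    rw [sSummand]
    ring_nf
  rw [sum_gb_mul_Trf hq tq_ne_zero, hS]
  congr 1
  by_cases hb : b ≤ M; swap
  · rw [sum_eq_zero, sum_eq_zero]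
    · intro k _
      rw [sSummand, qinv_of_neg (n := M - b - k) (by omega), mul_zero]
    · intro r _
      refine sum_eq_zero fun j _ => ?_
      rw [tSummand, qinv_of_neg (n := M - b - r - j) (by omega)]
      ring
  by_cases hL : a + b ≤ L; swap
  · rw [sum_eq_zero, sum_eq_zero]
    · intro k _
      rw [sSummand, qinv_of_neg (n := L - a - b - 2 * k) (by omega)]
      ring
    · intro r _
      refine sum_eq_zero fun j _ => ?_
      rw [tSummand, qinv_of_neg (n := L - a - b - r - j) (by omega)]
      ring
  exact sum_sum_tSummand hq hq0 (h hb hL)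

/-- Transformation theorem T→S: for `ab ≥ 0`, and `|a| ≤ M` whenever `|b| ≤ M` and
`|a+b| ≤ L`:
`Σ_{i=0}^M q^{i²/2} [L+M-i choose L] T(i, L-i, b, a) = q^{b²/2} S(L, M, a+b, b)`
(in the variable `t = q^{1/2}`, so `q = t^2`). -/
theorem T_to_S (L M : ℕ) (a b : ℤ) (hab : 0 ≤ a * b)
    (h : |b| ≤ (M : ℤ) → |a + b| ≤ (L : ℤ) → |a| ≤ (M : ℤ)) :
    ∑ i ∈ Finset.range (M + 1),
      tq ^ ((i : ℤ) ^ 2) * gb (tq ^ 2) ((L : ℤ) + M - i) L * Trf tq i ((L : ℤ) - i) b a =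
      tq ^ (b ^ 2) * Sr (tq ^ 2) L M (a + b) b := by
  wlog hb : 0 ≤ a ∧ 0 ≤ b generalizing a b
  · have hn : 0 ≤ -a ∧ 0 ≤ -b := by
      rcases mul_nonneg_iff.mp hab with h' | h'
      · exact absurd h' hb
      · omega
    have := this (-a) (-b) (by linarith) (by rwa [← neg_add, abs_neg, abs_neg, abs_neg]) hn
    simp only [Trf_neg, neg_sq] at this
    rw [this]
    obtain ⟨c, hc⟩ := Int.eq_ofNat_of_zero_le (add_nonneg hn.1 hn.2)
    rw [hc, ← Sr_neg, ← hc, neg_neg, neg_add, neg_neg, neg_neg]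
  obtain ⟨ha, hb⟩ := hb
  lift a to ℕ using ha
  lift b to ℕ using hb
  exact T_to_S_of_nonneg L M a b fun h1 h2 => by
    simpa using h (by simpa using h1) (by rw [abs_of_nonneg (by omega)]; omega)
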